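/- arXiv:math/0604201 — 2 statements merged into one kernel-verified Lean document; each statement's English description precedes it below -/
import Mathlib

section
/- Let f be a monotone (nondecreasing or nonincreasing) convex real function defined on an interval [a,b] with 0 ∈ [a,b] and f(0) ≤ 0, let A be an n×n Hermitian complex matrix whose spectrum lies in [a,b], and let Z be an n×n contraction (Z*Z ≤ I). Then there exists an n×n unitary matrix U such that f(Z*AZ) ≤ U Z* f(A) Z U* in the Loewner order. -/
open Matrix ComplexOrder

/-- Functional calculus: apply `f : ℝ → ℝ` to a Hermitian matrix via its spectral
decomposition `A = Σ λ_k u_k u_k*`, i.e. `f(A) = Σ f(λ_k) u_k u_k*`;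
junk value `0` if the matrix is not Hermitian. -/
noncomputable def matFun {n : ℕ} (A : Matrix (Fin n) (Fin n) ℂ) (f : ℝ → ℝ) :
    Matrix (Fin n) (Fin n) ℂ :=
  if h : A.IsHermitian then
    (h.eigenvectorUnitary : Matrix (Fin n) (Fin n) ℂ) *
      Matrix.diagonal (fun i => (f (h.eigenvalues i) : ℂ)) *
      star (h.eigenvectorUnitary : Matrix (Fin n) (Fin n) ℂ)
  else 0

lemma exists_sorted_diagonalization {n : ℕ} {M : Matrix (Fin n) (Fin n) ℂ} (hM : M.IsHermitian)
    (f : ℝ → ℝ) :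
    ∃ (V : Matrix (Fin n) (Fin n) ℂ) (β : Fin n → ℝ), Vᴴ * V = 1 ∧
      (∀ i, β i ∈ Set.range hM.eigenvalues) ∧ Monotone (fun i => f (β i)) ∧
      M = V * diagonal (fun i => (β i : ℂ)) * Vᴴ ∧
      matFun M f = V * diagonal (fun i => (f (β i) : ℂ)) * Vᴴ := by
  set V₀ : Matrix (Fin n) (Fin n) ℂ := (hM.eigenvectorUnitary : Matrix (Fin n) (Fin n) ℂ)
  set σ := Tuple.sort (fun i => f (hM.eigenvalues i))
  have hV₀u : V₀ᴴ * V₀ = 1 := (Matrix.mem_unitaryGroup_iff').1 hM.eigenvectorUnitary.2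
  have key (d : Fin n → ℂ) :
      V₀.submatrix id σ * diagonal (fun i => d (σ i)) * (V₀.submatrix id σ)ᴴ
        = V₀ * diagonal d * V₀ᴴ := by
    have : diagonal (fun i => d (σ i)) = (diagonal d).submatrix σ σ := by
      ext i j; simp [diagonal_apply]
    rw [this, conjTranspose_submatrix, submatrix_mul_equiv, submatrix_mul_equiv, submatrix_id_id]
  refine ⟨V₀.submatrix id σ, fun i => hM.eigenvalues (σ i), ?_, fun i => ⟨σ i, rfl⟩,
    Tuple.monotone_sort (fun i => f (hM.eigenvalues i)), ?_, ?_⟩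
  · rw [conjTranspose_submatrix, ← submatrix_mul V₀ᴴ V₀ σ id σ Function.bijective_id, hV₀u,
      submatrix_one_equiv]
  · rw [key (fun i => (hM.eigenvalues i : ℂ))]
    have h := hM.spectral_theorem
    rw [Unitary.conjStarAlgAut_apply] at h
    exact h
  · rw [key (fun i => (f (hM.eigenvalues i) : ℂ)), matFun, dif_pos hM, star_eq_conjTranspose]

lemma dotProduct_conj_diagonal_mulVec {n : ℕ} (V : Matrix (Fin n) (Fin n) ℂ) (d : Fin n → ℝ)
    (x : Fin n → ℂ) :
    star x ⬝ᵥ (V * diagonal (fun i => (d i : ℂ)) * Vᴴ) *ᵥ x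
      = ((∑ i, Complex.normSq ((Vᴴ *ᵥ x) i) * d i : ℝ) : ℂ) := by
  have h : star x ᵥ* V = star (Vᴴ *ᵥ x) := by
    rw [star_mulVec, conjTranspose_conjTranspose]
  rw [← mulVec_mulVec, ← mulVec_mulVec, dotProduct_mulVec, h]
  simp only [dotProduct, mulVec_diagonal, Pi.star_apply, Complex.ofReal_sum, Complex.ofReal_mul]
  refine Finset.sum_congr rfl fun i _ => ?_
  rw [Complex.normSq_eq_conj_mul_self, Complex.star_def]
  ring

lemma sum_normSq_conjTranspose_mulVec {n : ℕ} {V : Matrix (Fin n) (Fin n) ℂ} (hV : Vᴴ * V = 1)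
    (x : Fin n → ℂ) :
    ((∑ i, Complex.normSq ((Vᴴ *ᵥ x) i) : ℝ) : ℂ) = star x ⬝ᵥ x := by
  have h := dotProduct_conj_diagonal_mulVec V (fun _ => 1) x
  simp only [Complex.ofReal_one, mul_one, diagonal_one, mul_eq_one_comm.1 hV, one_mulVec] at h
  exact h.symm

lemma dotProduct_conjTranspose_mul_mul {n : ℕ} (Z M : Matrix (Fin n) (Fin n) ℂ)
    (x : Fin n → ℂ) :
    star x ⬝ᵥ (Zᴴ * M * Z) *ᵥ x = star (Z *ᵥ x) ⬝ᵥ M *ᵥ (Z *ᵥ x) := by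
  rw [← mulVec_mulVec, ← mulVec_mulVec, dotProduct_mulVec, ← star_mulVec]

/-- Jensen's inequality for weights of total mass at most one. -/
lemma ConvexOn.map_sum_le_of_sum_le_one {ι : Type*} [Fintype ι] {s : Set ℝ} {f : ℝ → ℝ}
    (hf : ConvexOn ℝ s f) (h0 : (0 : ℝ) ∈ s) (hf0 : f 0 ≤ 0) {p t : ι → ℝ}
    (hp : ∀ i, 0 ≤ p i) (hp1 : ∑ i, p i ≤ 1) (ht : ∀ i, t i ∈ s) :
    ∑ i, p i * t i ∈ s ∧ f (∑ i, p i * t i) ≤ ∑ i, p i * f (t i) := by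
  let w : Option ι → ℝ := fun o => o.elim (1 - ∑ i, p i) p
  let y : Option ι → ℝ := fun o => o.elim 0 t
  have hw : ∀ o ∈ Finset.univ, 0 ≤ w o := by
    rintro (_ | i) -
    · exact sub_nonneg.2 hp1
    · exact hp i
  have hw1 : ∑ o, w o = 1 := by simp [Fintype.sum_option, w]
  have hy : ∀ o ∈ Finset.univ, y o ∈ s := by
    rintro (_ | i) -
    · exact h0
    · exact ht i
  have hmem := hf.1.sum_mem hw hw1 hy
  have hle := hf.map_sum_le hw hw1 hy
  simp only [Fintype.sum_option, w, y, Option.elim, smul_eq_mul, mul_zero, zero_add] at hmem hle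
  refine ⟨hmem, hle.trans ?_⟩
  have := mul_nonpos_of_nonneg_of_nonpos (sub_nonneg.2 hp1) hf0
  linarith

lemma exists_ne_zero_mulVec_eq_zero {n : ℕ} (V W : Matrix (Fin n) (Fin n) ℂ) (i : Fin n) :
    ∃ x : Fin n → ℂ, x ≠ 0 ∧ (∀ j < i, (V *ᵥ x) j = 0) ∧ ∀ j > i, (W *ᵥ x) j = 0 := by
  let M : Matrix (Fin n) (Fin n) ℂ := fun j => if j < i then V j else if i < j then W j else 0
  have hdet : M.det = 0 := det_eq_zero_of_row_eq_zero i fun k => by simp [M]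
  obtain ⟨x, hx, hMx⟩ := exists_mulVec_eq_zero_iff.2 hdet
  refine ⟨x, hx, fun j hj => ?_, fun j hj => ?_⟩
  · simpa [mulVec, M, hj] using congrFun hMx j
  · simpa [mulVec, M, hj, not_lt_of_gt hj] using congrFun hMx j

/-- A Courant–Fischer comparison of eigenvalues: if `V` diagonalizes `f(B)` and `W` diagonalizes
`C`, with eigenvalues in increasing order, and `f ⟨Bx, x⟩ ≤ ⟨Cx, x⟩` for unit vectors `x`, then the
eigenvalues of `f(B)` are dominated by those of `C`, provided `f` is quasiconcave. -/
lemma eigenvalue_le_of_quasiconcaveOn {n : ℕ} {s : Set ℝ} {f : ℝ → ℝ} (hf : QuasiconcaveOn ℝ s f)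
    {V W : Matrix (Fin n) (Fin n) ℂ} (hV : Vᴴ * V = 1) (hW : Wᴴ * W = 1) {β γ : Fin n → ℝ}
    (hβ : ∀ i, β i ∈ s) (hfβ : Monotone fun i => f (β i)) (hγ : Monotone γ)
    (h : ∀ x : Fin n → ℂ, star x ⬝ᵥ x = 1 →
      f (∑ i, Complex.normSq ((Vᴴ *ᵥ x) i) * β i) ≤ ∑ i, Complex.normSq ((Wᴴ *ᵥ x) i) * γ i)
    (i : Fin n) : f (β i) ≤ γ i := by
  obtain ⟨y, hy, hVy, hWy⟩ := exists_ne_zero_mulVec_eq_zero Vᴴ Wᴴ i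
  obtain ⟨x, hx, hVx, hWx⟩ : ∃ x : Fin n → ℂ, star x ⬝ᵥ x = 1 ∧
      (∀ j < i, (Vᴴ *ᵥ x) j = 0) ∧ ∀ j > i, (Wᴴ *ᵥ x) j = 0 := by
    set r : ℝ := ∑ i, Complex.normSq ((Vᴴ *ᵥ y) i)
    have hr : (r : ℂ) = star y ⬝ᵥ y := sum_normSq_conjTranspose_mulVec hV y
    have hr0 : 0 < r := by
      refine lt_of_le_of_ne (Finset.sum_nonneg fun _ _ => Complex.normSq_nonneg _) fun h0 => hy ?_
      rw [← h0, Complex.ofReal_zero] at hr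
      exact dotProduct_star_self_eq_zero.1 hr.symm
    refine ⟨((Real.sqrt r)⁻¹ : ℂ) • y, ?_, fun j hj => ?_, fun j hj => ?_⟩
    · rw [star_smul, smul_dotProduct, dotProduct_smul, ← hr, smul_eq_mul, smul_eq_mul,
        ← Complex.ofReal_inv, Complex.star_def, Complex.conj_ofReal, ← Complex.ofReal_mul,
        ← Complex.ofReal_mul, ← Complex.ofReal_one]
      congr 1
      have := Real.mul_self_sqrt hr0.le
      have := (Real.sqrt_pos.2 hr0).ne'
      field_simp
      linarith
    · rw [mulVec_smul, Pi.smul_apply, hVy j hj, smul_zero]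
    · rw [mulVec_smul, Pi.smul_apply, hWy j hj, smul_zero]
  have hVsum : ∑ j, Complex.normSq ((Vᴴ *ᵥ x) j) = 1 := by
    exact_mod_cast (sum_normSq_conjTranspose_mulVec hV x).trans hx
  have hWsum : ∑ j, Complex.normSq ((Wᴴ *ᵥ x) j) = 1 := by
    exact_mod_cast (sum_normSq_conjTranspose_mulVec hW x).trans hx
  have hlow : f (β i) ≤ f (∑ j, Complex.normSq ((Vᴴ *ᵥ x) j) * β j) := by
    have hmem : ∑ j ∈ Finset.Ici i, Complex.normSq ((Vᴴ *ᵥ x) j) • β j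
        ∈ {t ∈ s | f (β i) ≤ f t} := by
      refine (hf (f (β i))).sum_mem (fun _ _ => Complex.normSq_nonneg _) ?_
        fun j hj => ⟨hβ j, hfβ (Finset.mem_Ici.1 hj)⟩
      rw [← hVsum]
      refine Finset.sum_subset (Finset.subset_univ _) fun j _ hj => ?_
      rw [hVx j (by simpa using hj), map_zero]
    have heq : ∑ j ∈ Finset.Ici i, Complex.normSq ((Vᴴ *ᵥ x) j) • β j
        = ∑ j, Complex.normSq ((Vᴴ *ᵥ x) j) * β j := by
      refine Finset.sum_subset (Finset.subset_univ _) fun j _ hj => ?_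
      rw [hVx j (by simpa using hj), map_zero, zero_smul]
    exact heq ▸ hmem.2
  refine (hlow.trans (h x hx)).trans ?_
  calc ∑ j, Complex.normSq ((Wᴴ *ᵥ x) j) * γ j
      ≤ ∑ j, Complex.normSq ((Wᴴ *ᵥ x) j) * γ i := by
        refine Finset.sum_le_sum fun j _ => ?_
        rcases le_or_gt j i with hj | hj
        · exact mul_le_mul_of_nonneg_left (hγ hj) (Complex.normSq_nonneg _)
        · rw [hWx j hj, map_zero, zero_mul, zero_mul]
    _ = γ i := by rw [← Finset.sum_mul, hWsum, one_mul]

lemma exists_unitary_conj_sub_posSemidef {n : ℕ} {V W : Matrix (Fin n) (Fin n) ℂ}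
    (hV : Vᴴ * V = 1) (hW : Wᴴ * W = 1) {β γ : Fin n → ℝ} (h : ∀ i, β i ≤ γ i) :
    ∃ U : Matrix (Fin n) (Fin n) ℂ, Uᴴ * U = 1 ∧
      (U * (W * diagonal (fun i => (γ i : ℂ)) * Wᴴ) * Uᴴ
        - V * diagonal (fun i => (β i : ℂ)) * Vᴴ).PosSemidef := by
  refine ⟨V * Wᴴ, ?_, ?_⟩
  · rw [conjTranspose_mul, conjTranspose_conjTranspose, Matrix.mul_assoc, ← Matrix.mul_assoc Vᴴ,
      hV, Matrix.one_mul, mul_eq_one_comm.1 hW]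
  · have hconj : V * Wᴴ * (W * diagonal (fun i => (γ i : ℂ)) * Wᴴ) * (V * Wᴴ)ᴴ
        = V * diagonal (fun i => (γ i : ℂ)) * Vᴴ := by
      calc _ = V * (Wᴴ * W) * diagonal (fun i => (γ i : ℂ)) * (Wᴴ * W) * Vᴴ := by
            simp only [conjTranspose_mul, conjTranspose_conjTranspose, Matrix.mul_assoc]
        _ = _ := by rw [hW, Matrix.mul_one, Matrix.mul_one]
    rw [hconj, ← Matrix.sub_mul, ← Matrix.mul_sub, diagonal_sub]
    refine PosSemidef.mul_mul_conjTranspose_same (PosSemidef.diagonal fun i => ?_) V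
    rw [← Complex.ofReal_sub]
    exact Complex.zero_le_real.2 (sub_nonneg.2 (h i))

/-- for a monotone convex `f` on `[a,b]` with `0 ∈ [a,b]`, `f(0) ≤ 0`,
a Hermitian `A` with spectrum in `[a,b]` and a contraction `Z`, there is a unitary `U`
with `f(ZᴴAZ) ≤ U Zᴴ f(A) Z Uᴴ`. -/
theorem contraction_monotone_convex {n : ℕ} {a b : ℝ} {f : ℝ → ℝ}
    (hconv : ConvexOn ℝ (Set.Icc a b) f)
    (hmono : MonotoneOn f (Set.Icc a b) ∨ AntitoneOn f (Set.Icc a b))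
    (h0mem : (0 : ℝ) ∈ Set.Icc a b) (hf0 : f 0 ≤ 0)
    (A : Matrix (Fin n) (Fin n) ℂ) (hA : A.IsHermitian)
    (hspec : ∀ i, hA.eigenvalues i ∈ Set.Icc a b)
    (Z : Matrix (Fin n) (Fin n) ℂ) (hZ : (1 - Zᴴ * Z).PosSemidef) :
    ∃ U : Matrix (Fin n) (Fin n) ℂ, Uᴴ * U = 1 ∧
      (U * (Zᴴ * matFun A f * Z) * Uᴴ - matFun (Zᴴ * A * Z) f).PosSemidef := by
  obtain ⟨P, α, hP, hα, -, hAP, hfAP⟩ := exists_sorted_diagonalization hA f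
  have hα' (i) : α i ∈ Set.Icc a b := by
    obtain ⟨j, hj⟩ := hα i
    exact hj ▸ hspec j
  have hfA : (matFun A f).IsHermitian := by
    rw [hfAP]
    refine isHermitian_mul_mul_conjTranspose P (isHermitian_diagonal_of_self_adjoint _ ?_)
    ext i
    simp
  have hB : (Zᴴ * A * Z).IsHermitian := isHermitian_conjTranspose_mul_mul Z hA
  have hC : (Zᴴ * matFun A f * Z).IsHermitian := isHermitian_conjTranspose_mul_mul Z hfA
  obtain ⟨V, β, hV, -, hfβ, hBV, hfBV⟩ := exists_sorted_diagonalization hB f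
  obtain ⟨W, γ, hW, -, hγ, hCW, -⟩ := exists_sorted_diagonalization hC id
  have jensen (x : Fin n → ℂ) (hx : star x ⬝ᵥ x = 1) :
      ∑ i, Complex.normSq ((Vᴴ *ᵥ x) i) * β i ∈ Set.Icc a b ∧
      f (∑ i, Complex.normSq ((Vᴴ *ᵥ x) i) * β i)
        ≤ ∑ i, Complex.normSq ((Wᴴ *ᵥ x) i) * γ i := by
    have hβsum : ∑ i, Complex.normSq ((Vᴴ *ᵥ x) i) * β i
        = ∑ i, Complex.normSq ((Pᴴ *ᵥ (Z *ᵥ x)) i) * α i := by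
      have h := dotProduct_conjTranspose_mul_mul Z A x
      rw [hBV, dotProduct_conj_diagonal_mulVec, hAP, dotProduct_conj_diagonal_mulVec] at h
      exact_mod_cast h
    have hγsum : ∑ i, Complex.normSq ((Wᴴ *ᵥ x) i) * γ i
        = ∑ i, Complex.normSq ((Pᴴ *ᵥ (Z *ᵥ x)) i) * f (α i) := by
      have h := dotProduct_conjTranspose_mul_mul Z (matFun A f) x
      rw [hCW, dotProduct_conj_diagonal_mulVec, hfAP, dotProduct_conj_diagonal_mulVec] at h
      exact_mod_cast h
    have hmass : ∑ i, Complex.normSq ((Pᴴ *ᵥ (Z *ᵥ x)) i) ≤ 1 := by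
      have h := hZ.dotProduct_mulVec_nonneg x
      have hZx := dotProduct_conjTranspose_mul_mul Z 1 x
      rw [Matrix.mul_one, one_mulVec] at hZx
      rw [sub_mulVec, one_mulVec, dotProduct_sub, hx, hZx,
        ← sum_normSq_conjTranspose_mulVec hP] at h
      exact_mod_cast sub_nonneg.1 h
    rw [hβsum, hγsum]
    exact hconv.map_sum_le_of_sum_le_one h0mem hf0 (fun _ => Complex.normSq_nonneg _) hmass hα'
  have hβ (i) : β i ∈ Set.Icc a b := by
    have hVe : Vᴴ *ᵥ (V *ᵥ Pi.single i 1) = Pi.single i 1 := by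
      rw [mulVec_mulVec, hV, one_mulVec]
    have hunit : star (V *ᵥ Pi.single i 1) ⬝ᵥ (V *ᵥ Pi.single i 1) = 1 := by
      rw [← sum_normSq_conjTranspose_mulVec hV, hVe]
      simp [Pi.single_apply, apply_ite Complex.normSq]
    have h := (jensen _ hunit).1
    rw [hVe] at h
    simpa [Pi.single_apply, apply_ite Complex.normSq] using h
  have hquasi : QuasiconcaveOn ℝ (Set.Icc a b) f :=
    hmono.elim (fun h => h.quasiconcaveOn (convex_Icc a b))
      (fun h => h.quasiconcaveOn (convex_Icc a b))
  have hle := eigenvalue_le_of_quasiconcaveOn hquasi hV hW hβ hfβ hγ fun x hx => (jensen x hx).2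
  rw [hfBV, hCW]
  exact exists_unitary_conj_sub_posSemidef hV hW hle
end

section
/- Let f : [0,∞) → [0,∞) be a continuous bijection with f(0) = 0 (hence f(t) → ∞ as t → ∞). The following are equivalent: (1) the function g(t) = 1/f(1/t) is convex on (0,∞); (2) for every n, every positive semidefinite n×n complex matrix A and every expansive n×n matrix Z (Z*Z ≥ I), there exists an n×n unitary matrix U such that Z* f(A) Z ≤ U f(Z*AZ) U* in the Loewner order. -/
open Matrix ComplexOrder

/-! ### Quadratic forms and the spectral decomposition -/

/-- The squared Euclidean norm of a complex vector. -/
noncomputable def sumSq {n : ℕ} (v : Fin n → ℂ) : ℝ := ∑ i, ‖v i‖ ^ 2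

lemma star_dotProduct_diagonal {n : ℕ} (d : Fin n → ℝ) (w : Fin n → ℂ) :
    star w ⬝ᵥ (diagonal (fun i => (d i : ℂ)) *ᵥ w) = ((∑ i, d i * ‖w i‖ ^ 2 : ℝ) : ℂ) := by
  simp only [dotProduct, mulVec_diagonal, Pi.star_apply]
  push_cast
  refine Finset.sum_congr rfl fun i _ => ?_
  rw [← Complex.conj_mul' (w i)]
  simp only [RCLike.star_def]
  ring

lemma star_dotProduct_self_eq_sumSq {n : ℕ} (w : Fin n → ℂ) :
    star w ⬝ᵥ w = (sumSq w : ℂ) := by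
  simpa [sumSq] using star_dotProduct_diagonal (fun _ => 1) w

lemma star_dotProduct_conj_mulVec {n : ℕ} (B M : Matrix (Fin n) (Fin n) ℂ) (v : Fin n → ℂ) :
    star v ⬝ᵥ ((Bᴴ * M * B) *ᵥ v) = star (B *ᵥ v) ⬝ᵥ (M *ᵥ (B *ᵥ v)) := by
  rw [star_mulVec, ← dotProduct_mulVec, mulVec_mulVec, mulVec_mulVec, Matrix.mul_assoc]

lemma sumSq_pos {n : ℕ} {v : Fin n → ℂ} (hv : v ≠ 0) : 0 < sumSq v := by
  obtain ⟨i, hi⟩ := Function.ne_iff.mp hv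
  refine Finset.sum_pos' (fun j _ => by positivity) ⟨i, Finset.mem_univ i, ?_⟩
  have := norm_pos_iff.mpr hi
  positivity

lemma sumSq_le_sumSq_mulVec {n : ℕ} {Z : Matrix (Fin n) (Fin n) ℂ}
    (hZ : (Zᴴ * Z - 1).PosSemidef) (v : Fin n → ℂ) : sumSq v ≤ sumSq (Z *ᵥ v) := by
  have h := hZ.dotProduct_mulVec_nonneg v
  have h2 := star_dotProduct_conj_mulVec Z 1 v
  rw [Matrix.mul_one, one_mulVec] at h2
  rw [sub_mulVec, one_mulVec, dotProduct_sub, h2, star_dotProduct_self_eq_sumSq,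
    star_dotProduct_self_eq_sumSq] at h
  exact_mod_cast sub_nonneg.mp h

lemma sumSq_mulVec_of_isometry {n : ℕ} {V : Matrix (Fin n) (Fin n) ℂ}
    (hV : Vᴴ * V = 1) (v : Fin n → ℂ) : sumSq (V *ᵥ v) = sumSq v := by
  have h2 := star_dotProduct_conj_mulVec V 1 v
  rw [Matrix.mul_one, one_mulVec, hV, one_mulVec, star_dotProduct_self_eq_sumSq,
    star_dotProduct_self_eq_sumSq] at h2
  exact_mod_cast h2.symm

lemma isUnit_of_expansive {n : ℕ} {Z : Matrix (Fin n) (Fin n) ℂ}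
    (hZ : (Zᴴ * Z - 1).PosSemidef) : IsUnit Z.det := by
  rw [isUnit_iff_ne_zero]
  intro h
  obtain ⟨v, hv, hv0⟩ := exists_mulVec_eq_zero_iff.mpr h
  have h1 := sumSq_le_sumSq_mulVec hZ v
  rw [hv0] at h1
  have h2 := sumSq_pos hv
  simp [sumSq] at h1 h2
  linarith

lemma conjTranspose_expansive {n : ℕ} {Z : Matrix (Fin n) (Fin n) ℂ}
    (hZ : (Zᴴ * Z - 1).PosSemidef) : ((Zᴴ)ᴴ * Zᴴ - 1).PosSemidef := by
  have hu := isUnit_of_expansive hZ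
  have h1 : ((Zᴴ * Z - 1)ᴴ * (Zᴴ * Z - 1) + (Zᴴ * Z - 1)).PosSemidef :=
    (posSemidef_conjTranspose_mul_self _).add hZ
  have h2 := h1.conjTranspose_mul_mul_same Z⁻¹
  convert h2 using 1
  have e : (Zᴴ * Z - 1)ᴴ * (Zᴴ * Z - 1) + (Zᴴ * Z - 1) = Zᴴ * (Z * Zᴴ - 1) * Z := by
    simp only [conjTranspose_sub, conjTranspose_mul, conjTranspose_conjTranspose,
      conjTranspose_one]
    noncomm_ring
  have hl : (Z⁻¹)ᴴ * Zᴴ = 1 := by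
    rw [← conjTranspose_mul, mul_nonsing_inv _ hu, conjTranspose_one]
  rw [e, conjTranspose_conjTranspose]
  calc Z * Zᴴ - 1 = ((Z⁻¹)ᴴ * Zᴴ) * (Z * Zᴴ - 1) * (Z * Z⁻¹) := by
        rw [hl, mul_nonsing_inv _ hu, Matrix.one_mul, Matrix.mul_one]
    _ = _ := by simp only [Matrix.mul_assoc]

section Spectral

variable {n : ℕ} {A : Matrix (Fin n) (Fin n) ℂ}

lemma matFun_eq (h : A.IsHermitian) (f : ℝ → ℝ) :
    matFun A f = (h.eigenvectorUnitary : Matrix (Fin n) (Fin n) ℂ) *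
      Matrix.diagonal (fun i => (f (h.eigenvalues i) : ℂ)) *
      (h.eigenvectorUnitary : Matrix (Fin n) (Fin n) ℂ)ᴴ := by
  rw [matFun, dif_pos h, star_eq_conjTranspose]

lemma matFun_id (h : A.IsHermitian) : matFun A (fun x => x) = A := by
  rw [matFun_eq h]
  conv_rhs => rw [h.spectral_theorem]
  rfl

lemma eigenvectorUnitary_conjTranspose_mul (h : A.IsHermitian) :
    (h.eigenvectorUnitary : Matrix (Fin n) (Fin n) ℂ)ᴴ *
      (h.eigenvectorUnitary : Matrix (Fin n) (Fin n) ℂ) = 1 :=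
  Unitary.coe_star_mul_self _

lemma eigenvectorUnitary_mul_conjTranspose (h : A.IsHermitian) :
    (h.eigenvectorUnitary : Matrix (Fin n) (Fin n) ℂ) *
      (h.eigenvectorUnitary : Matrix (Fin n) (Fin n) ℂ)ᴴ = 1 :=
  Unitary.coe_mul_star_self _

/-- The coordinates of a vector in the eigenbasis of a Hermitian matrix. -/
noncomputable def eigenCoord (h : A.IsHermitian) (v : Fin n → ℂ) : Fin n → ℂ :=
  (h.eigenvectorUnitary : Matrix (Fin n) (Fin n) ℂ)ᴴ *ᵥ v

lemma sumSq_eigenCoord (h : A.IsHermitian) (v : Fin n → ℂ) :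
    sumSq (eigenCoord h v) = sumSq v :=
  sumSq_mulVec_of_isometry
    (by rw [conjTranspose_conjTranspose, eigenvectorUnitary_mul_conjTranspose]) v

lemma eigenCoord_matFun (h : A.IsHermitian) (f : ℝ → ℝ) (v : Fin n → ℂ) (i : Fin n) :
    eigenCoord h (matFun A f *ᵥ v) i = f (h.eigenvalues i) * eigenCoord h v i := by
  rw [matFun_eq h, eigenCoord, mulVec_mulVec, ← Matrix.mul_assoc, ← Matrix.mul_assoc,
    eigenvectorUnitary_conjTranspose_mul, Matrix.one_mul, ← mulVec_mulVec, mulVec_diagonal]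
  rfl

lemma eigenCoord_self (h : A.IsHermitian) (v : Fin n → ℂ) (i : Fin n) :
    eigenCoord h (A *ᵥ v) i = h.eigenvalues i * eigenCoord h v i := by
  simpa only [matFun_id h] using eigenCoord_matFun h (fun x => x) v i

lemma star_dotProduct_matFun (h : A.IsHermitian) (f : ℝ → ℝ) (v : Fin n → ℂ) :
    star v ⬝ᵥ (matFun A f *ᵥ v) =
      ((∑ i, f (h.eigenvalues i) * ‖eigenCoord h v i‖ ^ 2 : ℝ) : ℂ) := by
  have := star_dotProduct_conj_mulVec
    ((h.eigenvectorUnitary : Matrix (Fin n) (Fin n) ℂ)ᴴ)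
    (diagonal (fun i => (f (h.eigenvalues i) : ℂ))) v
  rw [conjTranspose_conjTranspose, ← matFun_eq h] at this
  rw [this, star_dotProduct_diagonal]
  rfl

lemma star_dotProduct_mulVec_self (h : A.IsHermitian) (v : Fin n → ℂ) :
    star v ⬝ᵥ (A *ᵥ v) =
      ((∑ i, h.eigenvalues i * ‖eigenCoord h v i‖ ^ 2 : ℝ) : ℂ) := by
  simpa only [matFun_id h] using star_dotProduct_matFun h (fun x => x) v

lemma matFun_mul (h : A.IsHermitian) (f g : ℝ → ℝ) :
    matFun A f * matFun A g = matFun A (fun x => f x * g x) := by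
  set V := (h.eigenvectorUnitary : Matrix (Fin n) (Fin n) ℂ) with hV
  calc matFun A f * matFun A g
      = V * (diagonal (fun i => (f (h.eigenvalues i) : ℂ)) * (Vᴴ * V) *
        diagonal (fun i => (g (h.eigenvalues i) : ℂ))) * Vᴴ := by
        rw [matFun_eq h, matFun_eq h]; simp only [Matrix.mul_assoc, hV]
    _ = matFun A (fun x => f x * g x) := by
        rw [eigenvectorUnitary_conjTranspose_mul, Matrix.mul_one, diagonal_mul_diagonal,
          matFun_eq h]
        simp only [Complex.ofReal_mul, hV]

lemma isHermitian_matFun (h : A.IsHermitian) (f : ℝ → ℝ) : (matFun A f).IsHermitian := by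
  rw [matFun_eq h]
  refine isHermitian_mul_mul_conjTranspose _ ?_
  rw [isHermitian_diagonal_iff]
  intro i
  simp [isSelfAdjoint_iff]

lemma matFun_diagonal (d : Fin n → ℝ) (f : ℝ → ℝ) :
    matFun (diagonal (fun i => (d i : ℂ))) f = diagonal (fun i => (f (d i) : ℂ)) := by
  have h : (diagonal (fun i => (d i : ℂ))).IsHermitian := by
    rw [isHermitian_diagonal_iff]; intro i; simp [isSelfAdjoint_iff]
  set V := (h.eigenvectorUnitary : Matrix (Fin n) (Fin n) ℂ) with hV
  have h1 : V * diagonal (fun i => (h.eigenvalues i : ℂ)) = diagonal (fun i => (d i : ℂ)) * V := by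
    conv_rhs => rw [← matFun_id h, matFun_eq h, Matrix.mul_assoc,
      eigenvectorUnitary_conjTranspose_mul, Matrix.mul_one]
  have h2 : V * diagonal (fun i => (f (h.eigenvalues i) : ℂ)) =
      diagonal (fun i => (f (d i) : ℂ)) * V := by
    ext i j
    have := congrFun (congrFun h1 i) j
    rw [mul_diagonal, diagonal_mul] at this ⊢
    by_cases hz : V i j = 0
    · simp [hz]
    · rw [mul_comm] at this
      have := mul_right_cancel₀ hz this
      have : h.eigenvalues j = d i := by exact_mod_cast this
      rw [this, mul_comm]
  rw [matFun_eq h, ← hV, h2, Matrix.mul_assoc, eigenvectorUnitary_mul_conjTranspose,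
    Matrix.mul_one]

/-- For each index `i` there is a nonzero vector `x` supported on eigenvectors of `K` with
eigenvalue at least the `i`-th one, such that `M x` is supported on eigenvectors of `H` with
eigenvalue at most the `i`-th one. -/
lemma exists_vector_between {H K : Matrix (Fin n) (Fin n) ℂ} (hH : H.IsHermitian)
    (hK : K.IsHermitian) (M : Matrix (Fin n) (Fin n) ℂ) (i : Fin n) :
    ∃ x : Fin n → ℂ, x ≠ 0 ∧
      (∀ j, eigenCoord hK x j ≠ 0 → hK.eigenvalues i ≤ hK.eigenvalues j) ∧
      (∀ j, eigenCoord hH (M *ᵥ x) j ≠ 0 → hH.eigenvalues j ≤ hH.eigenvalues i) := by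
  set e : Fin n → Fin (Fintype.card (Fin n)) :=
    ⇑(Fintype.equivOfCardEq (Fintype.card_fin (Fintype.card (Fin n)))).symm
  let T : Matrix (Fin n) (Fin n) ℂ := fun j => if e i < e j
    then (hK.eigenvectorUnitary : Matrix (Fin n) (Fin n) ℂ)ᴴ j
    else if e j < e i then ((hH.eigenvectorUnitary : Matrix (Fin n) (Fin n) ℂ)ᴴ * M) j
    else 0
  have hT : T.det = 0 := det_eq_zero_of_row_eq_zero i (by intro k; simp [T])
  obtain ⟨x, hx, hx0⟩ := exists_mulVec_eq_zero_iff.mpr hT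
  refine ⟨x, hx, fun j hj => ?_, fun j hj => ?_⟩
  · refine hK.eigenvalues₀_antitone (not_lt.mp fun hlt => hj ?_)
    have := congrFun hx0 j
    have hlt' : e i < e j := hlt
    simpa only [eigenCoord, mulVec, T, if_pos hlt', Pi.zero_apply] using this
  · refine hH.eigenvalues₀_antitone (not_lt.mp fun hlt => hj ?_)
    have := congrFun hx0 j
    have hlt' : e j < e i := hlt
    rw [eigenCoord, mulVec_mulVec]
    simpa only [mulVec, T, if_neg (not_lt.mpr hlt'.le), if_pos hlt', Pi.zero_apply] using this

end Spectral

/-! ### Scalar facts -/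

lemma strictMonoOn_of_bijOn {f : ℝ → ℝ} (hcont : ContinuousOn f (Set.Ici 0)) (hf0 : f 0 = 0)
    (hbij : Set.BijOn f (Set.Ici 0) (Set.Ici 0)) : StrictMonoOn f (Set.Ici 0) := by
  intro x hx y hy hxy
  have hy' : (0 : ℝ) ≤ y := hy
  have hsub : Set.Icc 0 y ⊆ Set.Ici (0 : ℝ) := fun z hz => hz.1
  exact ContinuousOn.strictMonoOn_of_injOn_Icc hy' (by rw [hf0]; exact hbij.mapsTo hy)
    (hcont.mono hsub) (hbij.injOn.mono hsub) ⟨hx, hxy.le⟩ ⟨hy', le_rfl⟩ hxy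

lemma ConvexOn.exists_support_line {g : ℝ → ℝ} {S : Set ℝ} (hg : ConvexOn ℝ S g) {x : ℝ}
    (hx : x ∈ interior S) : ∃ m : ℝ, ∀ y ∈ S, g x + m * (y - x) ≤ g y := by
  refine ⟨derivWithin g (Set.Ioi x) x, fun y hy => ?_⟩
  rcases lt_trichotomy y x with h | rfl | h
  · have h1 := hg.slope_le_leftDeriv_of_mem_interior hy hx h
    have h2 := hg.leftDeriv_le_rightDeriv_of_mem_interior hx
    have h3 := h1.trans h2
    rw [slope_def_field, div_le_iff₀ (by linarith)] at h3
    linarith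
  · simp
  · have h1 := hg.rightDeriv_le_slope_of_mem_interior hx hy h
    rw [slope_def_field, le_div_iff₀ (by linarith)] at h1
    linarith

lemma exists_weights {f : ℝ → ℝ} (hf0 : f 0 = 0)
    (hbij : Set.BijOn f (Set.Ici 0) (Set.Ici 0)) (hmono : StrictMonoOn f (Set.Ici 0))
    (hconv : ConvexOn ℝ (Set.Ioi 0) (fun t => (f t⁻¹)⁻¹)) {t : ℝ} (ht : 0 < t) :
    ∃ m c : ℝ, 0 ≤ m ∧ 0 ≤ c ∧ m / t - c = 1 / f t ∧
      ∀ a, 0 ≤ a → m * (a * (f a / a * (f a / a))) - c * (f a * f a) ≤ f a := by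
  have hpos : ∀ a, 0 < a → 0 < f a := fun a ha => by
    simpa [hf0] using hmono (Set.mem_Ici.mpr le_rfl) (Set.mem_Ici.mpr ha.le) ha
  have ht' : 0 < t⁻¹ := inv_pos.mpr ht
  obtain ⟨m, hm⟩ := hconv.exists_support_line (x := t⁻¹) (by rwa [interior_Ioi])
  simp only [inv_inv, Set.mem_Ioi] at hm
  have hline : ∀ a, 0 < a → (f t)⁻¹ + m * (a⁻¹ - t⁻¹) ≤ (f a)⁻¹ := fun a ha => by
    simpa using hm a⁻¹ (inv_pos.mpr ha)
  have hm0 : 0 ≤ m := by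
    have h1 := hline (2 * t) (by positivity)
    have h2 : (f (2 * t))⁻¹ ≤ (f t)⁻¹ := by
      have := hmono (Set.mem_Ici.mpr ht.le) (Set.mem_Ici.mpr (by positivity : 0 ≤ 2 * t))
        (by linarith : t < 2 * t)
      exact inv_anti₀ (hpos t ht) this.le
    have h3 : (2 * t)⁻¹ - t⁻¹ = - (t⁻¹ / 2) := by field_simp; norm_num
    rw [h3] at h1
    by_contra! hneg
    nlinarith
  refine ⟨m, m / t - 1 / f t, hm0, ?_, by ring, fun a ha => ?_⟩
  · by_contra! hneg
    set c := m / t - 1 / f t with hc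
    obtain ⟨a, ha, hfa⟩ := hbij.surjOn
      (Set.mem_Ici.mpr (by have := neg_pos.mpr hneg; positivity : 0 ≤ 2 / (-c)))
    have ha0 : 0 < a := lt_of_le_of_ne ha (by
      rintro rfl
      rw [hf0] at hfa
      have : 0 < 2 / (-c) := by have := neg_pos.mpr hneg; positivity
      linarith)
    have h1 := hline a ha0
    rw [hfa, inv_div] at h1
    have h2 : 0 ≤ m * a⁻¹ := by positivity
    have h3 : (f t)⁻¹ + m * (a⁻¹ - t⁻¹) = m * a⁻¹ - c := by rw [hc]; ring
    linarith
  · rcases ha.eq_or_lt with rfl | ha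
    · simp [hf0]
    · have hfa := hpos a ha
      have h1 := mul_le_mul_of_nonneg_right (hline a ha) (mul_pos hfa hfa).le
      have h2 : (f a)⁻¹ * (f a * f a) = f a := by field_simp
      rw [h2] at h1
      refine le_trans (le_of_eq ?_) h1
      field_simp
      ring

/-! ### Convexity implies the operator inequality -/

lemma eigenvalues_le_of_convexOn {f : ℝ → ℝ} (hf0 : f 0 = 0)
    (hbij : Set.BijOn f (Set.Ici 0) (Set.Ici 0)) (hmono : StrictMonoOn f (Set.Ici 0))
    (hconv : ConvexOn ℝ (Set.Ioi 0) (fun t => (f t⁻¹)⁻¹)) {n : ℕ}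
    {A Z : Matrix (Fin n) (Fin n) ℂ} (hA : A.PosSemidef) (hZ : (Zᴴ * Z - 1).PosSemidef)
    (hH : (Zᴴ * A * Z).IsHermitian) (hK : (Zᴴ * matFun A f * Z).IsHermitian) (i : Fin n) :
    hK.eigenvalues i ≤ f (hH.eigenvalues i) := by
  set K := Zᴴ * matFun A f * Z with hKdef
  set H := Zᴴ * A * Z with hHdef
  have hu := isUnit_of_expansive hZ
  have hHpos : H.PosSemidef := hA.conjTranspose_mul_mul_same Z
  have hfnn : ∀ a, 0 ≤ a → 0 ≤ f a := fun a ha => hbij.mapsTo ha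
  have hA' := hA.isHermitian
  have hann := hA.eigenvalues_nonneg
  have htnn : ∀ j, 0 ≤ hH.eigenvalues j := hHpos.eigenvalues_nonneg
  obtain ⟨x, hx, hxK, hxH⟩ := exists_vector_between hH hK K i
  set p := eigenCoord hA' (Z *ᵥ x) with hp
  set u := Z⁻¹ *ᵥ (matFun A (fun a => f a / a) *ᵥ (Z *ᵥ x)) with hudef
  have hZu : Z *ᵥ u = matFun A (fun a => f a / a) *ᵥ (Z *ᵥ x) := by
    rw [hudef, mulVec_mulVec, mul_nonsing_inv _ hu, one_mulVec]
  have hfac : A *ᵥ (Z *ᵥ u) = matFun A f *ᵥ (Z *ᵥ x) := by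
    rw [hZu, mulVec_mulVec]
    have : A * matFun A (fun a => f a / a) = matFun A f := by
      conv_lhs => enter [1]; rw [← matFun_id hA']
      rw [matFun_mul hA']
      congr 1
      funext a
      by_cases ha : a = 0
      · simp [ha, hf0]
      · field_simp
    rw [this]
  have hHu : H *ᵥ u = K *ᵥ x := by
    rw [hHdef, hKdef, ← mulVec_mulVec, ← mulVec_mulVec, hfac, mulVec_mulVec, mulVec_mulVec,
      Matrix.mul_assoc]
  -- the quadratic form of `K` at `x`
  set Q := ∑ j, f (hA'.eigenvalues j) * ‖p j‖ ^ 2 with hQ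
  have hQ1 : star x ⬝ᵥ (K *ᵥ x) = (Q : ℂ) := by
    rw [hKdef, star_dotProduct_conj_mulVec, star_dotProduct_matFun hA']
  have hQ2 : Q = ∑ j, hK.eigenvalues j * ‖eigenCoord hK x j‖ ^ 2 := by
    have := star_dotProduct_mulVec_self hK x
    rw [hQ1] at this
    exact_mod_cast this
  -- the quadratic form of `H` at `u`
  set β := ∑ j, hA'.eigenvalues j * ‖eigenCoord hA' (Z *ᵥ u) j‖ ^ 2 with hβ
  have hβ1 : β = ∑ j, hH.eigenvalues j * ‖eigenCoord hH u j‖ ^ 2 := by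
    have h1 := star_dotProduct_mulVec_self hH u
    have h2 : star u ⬝ᵥ (H *ᵥ u) = (β : ℂ) := by
      rw [hHdef, star_dotProduct_conj_mulVec, star_dotProduct_mulVec_self hA']
    rw [h2] at h1
    exact_mod_cast h1
  have hβ2 : β = ∑ j, (hA'.eigenvalues j * (f (hA'.eigenvalues j) / hA'.eigenvalues j *
      (f (hA'.eigenvalues j) / hA'.eigenvalues j))) * ‖p j‖ ^ 2 := by
    refine Finset.sum_congr rfl fun j _ => ?_
    rw [hZu, eigenCoord_matFun, norm_mul, mul_pow, Complex.norm_real, Real.norm_eq_abs, sq_abs]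
    ring
  -- the squared norm of `K x`
  set N := sumSq (K *ᵥ x) with hN
  have hN1 : N = ∑ j, hH.eigenvalues j ^ 2 * ‖eigenCoord hH u j‖ ^ 2 := by
    rw [hN, ← hHu, ← sumSq_eigenCoord hH, sumSq]
    refine Finset.sum_congr rfl fun j _ => ?_
    rw [eigenCoord_self, norm_mul, mul_pow, Complex.norm_real, Real.norm_eq_abs, sq_abs]
  have hN2 : N = ∑ j, hK.eigenvalues j ^ 2 * ‖eigenCoord hK x j‖ ^ 2 := by
    rw [hN, ← sumSq_eigenCoord hK, sumSq]
    refine Finset.sum_congr rfl fun j _ => ?_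
    rw [eigenCoord_self, norm_mul, mul_pow, Complex.norm_real, Real.norm_eq_abs, sq_abs]
  have hN3 : ∑ j, (f (hA'.eigenvalues j) * f (hA'.eigenvalues j)) * ‖p j‖ ^ 2 ≤ N := by
    have h1 := sumSq_le_sumSq_mulVec (conjTranspose_expansive hZ) (matFun A f *ᵥ (Z *ᵥ x))
    have h2 : Zᴴ *ᵥ (matFun A f *ᵥ (Z *ᵥ x)) = K *ᵥ x := by
      rw [hKdef, mulVec_mulVec, mulVec_mulVec, Matrix.mul_assoc]
    rw [h2, ← sumSq_eigenCoord hA'] at h1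
    refine le_trans (le_of_eq (Finset.sum_congr rfl fun j _ => ?_)) h1
    rw [eigenCoord_matFun, norm_mul, mul_pow, Complex.norm_real, Real.norm_eq_abs, sq_abs]
    ring
  have hNβ : N ≤ hH.eigenvalues i * β := by
    rw [hN1, hβ1, Finset.mul_sum]
    refine Finset.sum_le_sum fun j _ => ?_
    by_cases hz : eigenCoord hH (K *ᵥ x) j = 0
    · rw [← hHu, eigenCoord_self] at hz
      rcases mul_eq_zero.mp hz with h | h
      · have : hH.eigenvalues j = 0 := by exact_mod_cast h
        simp [this]
      · simp [h]
    · have h1 := hxH j hz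
      rw [sq, mul_assoc]
      exact mul_le_mul_of_nonneg_right h1 (mul_nonneg (htnn j) (by positivity))
  by_contra! hlt
  have hκ : 0 < hK.eigenvalues i := lt_of_le_of_lt (hfnn _ (htnn i)) hlt
  have hQlow : hK.eigenvalues i * sumSq x ≤ Q := by
    rw [hQ2, ← sumSq_eigenCoord hK, sumSq, Finset.mul_sum]
    refine Finset.sum_le_sum fun j _ => ?_
    by_cases hz : eigenCoord hK x j = 0
    · simp [hz]
    · exact mul_le_mul_of_nonneg_right (hxK j hz) (by positivity)
  have hQpos : 0 < Q := lt_of_lt_of_le (mul_pos hκ (sumSq_pos hx)) hQlow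
  have hNlow : hK.eigenvalues i * Q ≤ N := by
    rw [hQ2, hN2, Finset.mul_sum]
    refine Finset.sum_le_sum fun j _ => ?_
    by_cases hz : eigenCoord hK x j = 0
    · simp [hz]
    · have h1 := hxK j hz
      rw [sq (hK.eigenvalues j), mul_assoc]
      exact mul_le_mul_of_nonneg_right h1 (mul_nonneg (hκ.le.trans h1) (by positivity))
  have hNpos : 0 < N := lt_of_lt_of_le (mul_pos hκ hQpos) hNlow
  have ht : 0 < hH.eigenvalues i := lt_of_le_of_ne (htnn i) (by
    intro h0
    rw [← h0, zero_mul] at hNβ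
    linarith)
  obtain ⟨m, c, hm, hc, hmc, hw⟩ := exists_weights hf0 hbij hmono hconv ht
  set t := hH.eigenvalues i with htdef
  have hft : 0 < f t := by
    simpa [hf0] using hmono (Set.mem_Ici.mpr le_rfl) (Set.mem_Ici.mpr ht.le) ht
  have hQge : m * β - c * N ≤ Q := by
    have h1 : m * β - c * ∑ j, (f (hA'.eigenvalues j) * f (hA'.eigenvalues j)) * ‖p j‖ ^ 2
        ≤ Q := by
      rw [hβ2, hQ, Finset.mul_sum, Finset.mul_sum, ← Finset.sum_sub_distrib]
      refine Finset.sum_le_sum fun j _ => ?_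
      have := mul_le_mul_of_nonneg_right (hw _ (hann j)) (sq_nonneg ‖p j‖)
      linarith
    have h2 := mul_le_mul_of_nonneg_left hN3 hc
    linarith
  have h3 : N / f t ≤ Q := by
    have h4 : N / t ≤ β := by rw [div_le_iff₀ ht]; linarith
    have h5 := mul_le_mul_of_nonneg_left h4 hm
    have h6 : N / f t = m * (N / t) - c * N := by
      rw [div_eq_mul_one_div, ← hmc]; ring
    linarith
  rw [div_le_iff₀ hft] at h3
  nlinarith

lemma exists_unitary_of_eigenvalues_le {n : ℕ} {H K : Matrix (Fin n) (Fin n) ℂ} {f : ℝ → ℝ}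
    (hH : H.IsHermitian) (hK : K.IsHermitian)
    (hle : ∀ i, hK.eigenvalues i ≤ f (hH.eigenvalues i)) :
    ∃ U : Matrix (Fin n) (Fin n) ℂ, Uᴴ * U = 1 ∧ (U * matFun H f * Uᴴ - K).PosSemidef := by
  set V := (hH.eigenvectorUnitary : Matrix (Fin n) (Fin n) ℂ) with hV
  set W := (hK.eigenvectorUnitary : Matrix (Fin n) (Fin n) ℂ) with hW
  have hV1 : Vᴴ * V = 1 := eigenvectorUnitary_conjTranspose_mul hH
  have hV2 : V * Vᴴ = 1 := eigenvectorUnitary_mul_conjTranspose hH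
  have hW1 : Wᴴ * W = 1 := eigenvectorUnitary_conjTranspose_mul hK
  refine ⟨W * Vᴴ, ?_, ?_⟩
  · rw [conjTranspose_mul, conjTranspose_conjTranspose]
    calc V * Wᴴ * (W * Vᴴ) = V * (Wᴴ * W) * Vᴴ := by simp only [Matrix.mul_assoc]
      _ = 1 := by rw [hW1, Matrix.mul_one, hV2]
  · set D := diagonal (fun i => (f (hH.eigenvalues i) : ℂ))
    set E := diagonal (fun i => (hK.eigenvalues i : ℂ))
    have e1 : W * Vᴴ * matFun H f * (W * Vᴴ)ᴴ = W * D * Wᴴ := by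
      rw [matFun_eq hH, conjTranspose_mul, conjTranspose_conjTranspose]
      calc W * Vᴴ * (V * D * Vᴴ) * (V * Wᴴ) = W * (Vᴴ * V) * D * (Vᴴ * V) * Wᴴ := by
            simp only [Matrix.mul_assoc]
        _ = _ := by rw [hV1, Matrix.mul_one, Matrix.mul_one]
    have e2 : K = W * E * Wᴴ := by
      conv_lhs => rw [← matFun_id hK, matFun_eq hK]
    have e3 : W * Vᴴ * matFun H f * (W * Vᴴ)ᴴ - K = W * (D - E) * Wᴴ := by
      rw [e1, Matrix.mul_sub, Matrix.sub_mul, ← e2]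
    rw [e3]
    refine PosSemidef.mul_mul_conjTranspose_same ?_ W
    rw [diagonal_sub, posSemidef_diagonal_iff]
    intro i
    rw [← Complex.ofReal_sub]
    exact_mod_cast sub_nonneg.mpr (hle i)

/-! ### The operator inequality implies convexity -/

/-- A scaled rotation by the unit vector `(p, q)`, stretching the second direction by `ε⁻¹`. -/
noncomputable def stretchedRotation (p q ε : ℝ) : Matrix (Fin 2) (Fin 2) ℂ :=
  !![(p : ℂ), ((-q / ε : ℝ) : ℂ); (q : ℂ), ((p / ε : ℝ) : ℂ)]

lemma stretchedRotation_expansive {p q ε : ℝ} (hpq : p ^ 2 + q ^ 2 = 1) (hε : 0 < ε)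
    (hε1 : ε ≤ 1) :
    ((stretchedRotation p q ε)ᴴ * stretchedRotation p q ε - 1).PosSemidef := by
  have h : (stretchedRotation p q ε)ᴴ * stretchedRotation p q ε - 1 =
      diagonal (fun i => ((![0, 1 / ε ^ 2 - 1] i : ℝ) : ℂ)) := by
    have e1 : p * p + q * q - 1 = 0 := by linarith
    have e2 : p * (-q / ε) + q * (p / ε) = 0 := by ring
    have e3 : -q / ε * p + p / ε * q = 0 := by ring
    have e4 : -q / ε * (-q / ε) + p / ε * (p / ε) - 1 = 1 / ε ^ 2 - 1 := by
      rw [← hpq]; ring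
    ext i j
    fin_cases i <;> fin_cases j <;>
      simp only [stretchedRotation, Fin.zero_eta, Fin.mk_one, Fin.isValue, Matrix.sub_apply, mul_apply,
        Fin.sum_univ_two, conjTranspose_apply, of_apply, cons_val', cons_val_zero, cons_val_one,
        cons_val_fin_one, RCLike.star_def, Complex.conj_ofReal, one_apply, diagonal_apply,
        if_true, zero_ne_one, one_ne_zero, if_false, sub_zero]
    · exact_mod_cast e1
    · exact_mod_cast e2
    · exact_mod_cast e3
    · exact_mod_cast e4
  rw [h, posSemidef_diagonal_iff]
  have hε2 : (0 : ℝ) ≤ 1 / ε ^ 2 - 1 := by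
    rw [sub_nonneg, le_div_iff₀ (by positivity)]
    nlinarith
  intro i
  fin_cases i
  · simp
  · exact_mod_cast hε2

lemma norm_add_sq_le {p q c d : ℝ} (hc : 0 < c) (hd : 0 < d) (z w : ℂ) :
    ‖(p : ℂ) * z + (q : ℂ) * w‖ ^ 2 ≤
      (c * ‖z‖ ^ 2 + d * ‖w‖ ^ 2) * (p ^ 2 / c + q ^ 2 / d) := by
  have h1 : ‖(p : ℂ) * z + (q : ℂ) * w‖ ≤ |p| * ‖z‖ + |q| * ‖w‖ := by
    refine (norm_add_le _ _).trans (le_of_eq ?_)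
    rw [norm_mul, norm_mul, Complex.norm_real, Complex.norm_real, Real.norm_eq_abs,
      Real.norm_eq_abs]
  have h2 := pow_le_pow_left₀ (norm_nonneg _) h1 2
  refine h2.trans ?_
  rw [← sq_abs p, ← sq_abs q]
  have key : (c * ‖z‖ ^ 2 + d * ‖w‖ ^ 2) * (|p| ^ 2 / c + |q| ^ 2 / d)
      - (|p| * ‖z‖ + |q| * ‖w‖) ^ 2 = (c * ‖z‖ * |q| - d * ‖w‖ * |p|) ^ 2 / (c * d) := by
    field_simp
    ring
  have : 0 ≤ (c * ‖z‖ * |q| - d * ‖w‖ * |p|) ^ 2 / (c * d) := by positivity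
  linarith

lemma one_le_mul_of_operator_inequality {f : ℝ → ℝ} (hf0 : f 0 = 0)
    (hmono : StrictMonoOn f (Set.Ici 0))
    (hop : ∀ n : ℕ, ∀ A : Matrix (Fin n) (Fin n) ℂ, A.PosSemidef →
      ∀ Z : Matrix (Fin n) (Fin n) ℂ, (Zᴴ * Z - 1).PosSemidef →
        ∃ U : Matrix (Fin n) (Fin n) ℂ, Uᴴ * U = 1 ∧
          (U * matFun (Zᴴ * A * Z) f * Uᴴ - Zᴴ * matFun A f * Z).PosSemidef)
    {a b p q ε : ℝ} (ha : 0 < a) (hb : 0 < b) (hpq : p ^ 2 + q ^ 2 = 1) (hε : 0 < ε)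
    (hε1 : ε ≤ 1) :
    1 ≤ f (p ^ 2 * a + q ^ 2 * b)⁻¹ * ((p ^ 2 / f a⁻¹ + q ^ 2 / f b⁻¹) +
      ε ^ 2 * (q ^ 2 / f a⁻¹ + p ^ 2 / f b⁻¹)) := by
  set σ := p ^ 2 * a + q ^ 2 * b with hσ
  have hσ0 : 0 < σ := by
    rcases eq_or_ne p 0 with rfl | hp
    · have : q ^ 2 = 1 := by linarith
      rw [hσ, this]; simpa using hb
    · positivity
  have hpos : ∀ a, 0 < a → 0 < f a := fun a ha => by
    simpa [hf0] using hmono (Set.mem_Ici.mpr le_rfl) (Set.mem_Ici.mpr ha.le) ha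
  have hfa := hpos a⁻¹ (inv_pos.mpr ha)
  have hfb := hpos b⁻¹ (inv_pos.mpr hb)
  set Z := stretchedRotation p q ε with hZdef
  have hZ : (Zᴴ * Z - 1).PosSemidef := stretchedRotation_expansive hpq hε hε1
  set d : Fin 2 → ℝ := ![a⁻¹, b⁻¹] with hd
  set A : Matrix (Fin 2) (Fin 2) ℂ := diagonal (fun i => (d i : ℂ)) with hAdef
  have hA : A.PosSemidef := by
    rw [hAdef, posSemidef_diagonal_iff]
    intro i
    fin_cases i
    · exact_mod_cast (inv_pos.mpr ha).le
    · exact_mod_cast (inv_pos.mpr hb).le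
  obtain ⟨U, hU, hUpos⟩ := hop 2 A hA Z hZ
  have hHpos : (Zᴴ * A * Z).PosSemidef := hA.conjTranspose_mul_mul_same Z
  have hH := hHpos.isHermitian
  have hAquad : ∀ y : Fin 2 → ℂ, star y ⬝ᵥ (A *ᵥ y) = ((∑ j, d j * ‖y j‖ ^ 2 : ℝ) : ℂ) :=
    star_dotProduct_diagonal d
  have hfAquad : ∀ y : Fin 2 → ℂ, star y ⬝ᵥ (matFun A f *ᵥ y) =
      ((∑ j, f (d j) * ‖y j‖ ^ 2 : ℝ) : ℂ) := fun y => by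
    rw [hAdef, matFun_diagonal]
    exact star_dotProduct_diagonal (fun j => f (d j)) y
  -- some eigenvalue is at most `σ⁻¹`
  obtain ⟨i, hi⟩ : ∃ i, hH.eigenvalues i ≤ σ⁻¹ := by
    by_contra! hall
    set x : Fin 2 → ℂ := ![(σ : ℂ), ((ε * (p * q * (b - a)) : ℝ) : ℂ)] with hx
    have hxne : x ≠ 0 := fun h => by
      have := congrFun h 0
      simp only [hx, cons_val_zero, Pi.zero_apply] at this
      exact hσ0.ne' (by exact_mod_cast this)
    have hZx : Z *ᵥ x = ![((a * p : ℝ) : ℂ), ((b * q : ℝ) : ℂ)] := by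
      have e1 : p * σ + -q / ε * (ε * (p * q * (b - a))) = a * p := by
        have : -q / ε * (ε * (p * q * (b - a))) = -q * (p * q * (b - a)) := by field_simp
        rw [this, hσ]
        linear_combination a * p * hpq
      have e2 : q * σ + p / ε * (ε * (p * q * (b - a))) = b * q := by
        have : p / ε * (ε * (p * q * (b - a))) = p * (p * q * (b - a)) := by field_simp
        rw [this, hσ]
        linear_combination b * q * hpq
      ext j
      fin_cases j <;>
        simp only [hZdef, stretchedRotation, hx, Fin.zero_eta, Fin.mk_one, Fin.isValue, mulVec,
          dotProduct, Fin.sum_univ_two, of_apply, cons_val', cons_val_zero, cons_val_one,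
          cons_val_fin_one]
      · exact_mod_cast e1
      · exact_mod_cast e2
    have hq : ∑ j, hH.eigenvalues j * ‖eigenCoord hH x j‖ ^ 2 = σ := by
      have h1 := star_dotProduct_mulVec_self hH x
      rw [star_dotProduct_conj_mulVec, hAquad, hZx] at h1
      have h2 := Complex.ofReal_injective h1
      rw [← h2, Fin.sum_univ_two]
      simp only [hd, cons_val_zero, cons_val_one, cons_val_fin_one, Complex.norm_real,
        Real.norm_eq_abs, sq_abs]
      field_simp
      rw [hσ]
      ring
    have hs : σ ^ 2 ≤ sumSq x := by
      rw [sumSq, Fin.sum_univ_two]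
      simp only [hx, cons_val_zero, cons_val_one, cons_val_fin_one, Complex.norm_real,
        Real.norm_eq_abs, sq_abs]
      nlinarith [sq_nonneg (ε * (p * q * (b - a)))]
    have hlt : σ⁻¹ * sumSq x < σ := by
      refine lt_of_lt_of_eq ?_ hq
      rw [← sumSq_eigenCoord hH x, sumSq, Finset.mul_sum]
      have hpos' := sumSq_pos hxne
      rw [← sumSq_eigenCoord hH x] at hpos'
      obtain ⟨j, -, hj⟩ := Finset.exists_lt_of_sum_lt
        (s := Finset.univ) (f := fun _ : Fin 2 => (0 : ℝ))
        (g := fun j => ‖eigenCoord hH x j‖ ^ 2) (by simpa [sumSq] using hpos')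
      exact Finset.sum_lt_sum
        (fun k _ => mul_le_mul_of_nonneg_right (hall k).le (by positivity))
        ⟨j, Finset.mem_univ j, mul_lt_mul_of_pos_right (hall j) hj⟩
    have h3 : σ⁻¹ * σ ^ 2 ≤ σ⁻¹ * sumSq x :=
      mul_le_mul_of_nonneg_left hs (inv_pos.mpr hσ0).le
    have h4 : σ⁻¹ * σ ^ 2 = σ := by field_simp
    linarith
  -- test the inequality on the image under `U` of the corresponding eigenvector
  set v : Fin 2 → ℂ :=
    (hH.eigenvectorUnitary : Matrix (Fin 2) (Fin 2) ℂ) *ᵥ Pi.single i 1 with hv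
  have hcv : eigenCoord hH v = Pi.single i 1 := by
    rw [eigenCoord, hv, mulVec_mulVec, eigenvectorUnitary_conjTranspose_mul, one_mulVec]
  have hsumv : sumSq v = 1 := by
    rw [← sumSq_eigenCoord hH, hcv, sumSq]
    rw [Finset.sum_eq_single i (fun j _ hj => by simp [hj]) (by simp)]
    simp
  set w := U *ᵥ v with hw
  have hsumw : sumSq w = 1 := by rw [hw, sumSq_mulVec_of_isometry hU, hsumv]
  have hUw : Uᴴ *ᵥ w = v := by rw [hw, mulVec_mulVec, hU, one_mulVec]
  set z := Z *ᵥ w with hz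
  have hquad : f a⁻¹ * ‖z 0‖ ^ 2 + f b⁻¹ * ‖z 1‖ ^ 2 ≤ f (hH.eigenvalues i) := by
    have h1 := hUpos.dotProduct_mulVec_nonneg w
    have h2 := star_dotProduct_conj_mulVec Uᴴ (matFun (Zᴴ * A * Z) f) w
    rw [conjTranspose_conjTranspose, hUw, star_dotProduct_matFun hH, hcv] at h2
    rw [sub_mulVec, dotProduct_sub, h2, star_dotProduct_conj_mulVec, hfAquad,
      sub_nonneg] at h1
    have h3 := Complex.real_le_real.mp h1
    have h4 : ∑ j, f (hH.eigenvalues j) * ‖(Pi.single i 1 : Fin 2 → ℂ) j‖ ^ 2 =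
        f (hH.eigenvalues i) := by
      rw [Finset.sum_eq_single i (fun j _ hj => by simp [hj]) (by simp)]
      simp
    rw [h4, Fin.sum_univ_two] at h3
    exact h3
  have hfi : f (hH.eigenvalues i) ≤ f σ⁻¹ :=
    hmono.monotoneOn (hHpos.eigenvalues_nonneg i) (Set.mem_Ici.mpr (inv_pos.mpr hσ0).le) hi
  have hz0 : z 0 = (p : ℂ) * w 0 + ((-q / ε : ℝ) : ℂ) * w 1 := by
    simp [hz, hZdef, stretchedRotation, dotProduct, Fin.sum_univ_two]
  have hz1 : z 1 = (q : ℂ) * w 0 + ((p / ε : ℝ) : ℂ) * w 1 := by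
    simp [hz, hZdef, stretchedRotation, dotProduct, Fin.sum_univ_two]
  have hpqC : (p : ℂ) ^ 2 + (q : ℂ) ^ 2 = 1 := by exact_mod_cast hpq
  have hεC : (ε : ℂ) ≠ 0 := by exact_mod_cast hε.ne'
  have hw0 : w 0 = (p : ℂ) * z 0 + (q : ℂ) * z 1 := by
    rw [hz0, hz1]
    push_cast
    linear_combination (- w 0) * hpqC
  have hw1 : w 1 = (ε : ℂ) * (((-q : ℝ) : ℂ) * z 0 + (p : ℂ) * z 1) := by
    rw [hz0, hz1]
    push_cast
    field_simp
    linear_combination (- w 1) * hpqC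
  have hn0 := norm_add_sq_le (p := p) (q := q) hfa hfb (z 0) (z 1)
  have hn1 := norm_add_sq_le (p := -q) (q := p) hfa hfb (z 0) (z 1)
  rw [← hw0] at hn0
  have hn1' : ‖w 1‖ ^ 2 ≤ ε ^ 2 * ((f a⁻¹ * ‖z 0‖ ^ 2 + f b⁻¹ * ‖z 1‖ ^ 2) *
      (q ^ 2 / f a⁻¹ + p ^ 2 / f b⁻¹)) := by
    rw [hw1, norm_mul, mul_pow, Complex.norm_real, Real.norm_eq_abs, sq_abs]
    rw [neg_sq] at hn1
    exact mul_le_mul_of_nonneg_left hn1 (by positivity)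
  rw [sumSq, Fin.sum_univ_two] at hsumw
  have hle := mul_le_mul_of_nonneg_right (hquad.trans hfi)
    (by positivity : 0 ≤ (p ^ 2 / f a⁻¹ + q ^ 2 / f b⁻¹) +
      ε ^ 2 * (q ^ 2 / f a⁻¹ + p ^ 2 / f b⁻¹))
  nlinarith

lemma convexOn_of_operator_inequality {f : ℝ → ℝ} (hf0 : f 0 = 0)
    (hmono : StrictMonoOn f (Set.Ici 0))
    (hop : ∀ n : ℕ, ∀ A : Matrix (Fin n) (Fin n) ℂ, A.PosSemidef →
      ∀ Z : Matrix (Fin n) (Fin n) ℂ, (Zᴴ * Z - 1).PosSemidef →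
        ∃ U : Matrix (Fin n) (Fin n) ℂ, Uᴴ * U = 1 ∧
          (U * matFun (Zᴴ * A * Z) f * Uᴴ - Zᴴ * matFun A f * Z).PosSemidef) :
    ConvexOn ℝ (Set.Ioi 0) (fun t => (f t⁻¹)⁻¹) := by
  refine ⟨convex_Ioi 0, fun a ha b hb α β hα hβ hαβ => ?_⟩
  simp only [smul_eq_mul]
  rw [Set.mem_Ioi] at ha hb
  have hσ : 0 < α * a + β * b := convex_Ioi (0 : ℝ) ha hb hα hβ hαβ
  have hfσ : 0 < f (α * a + β * b)⁻¹ := by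
    simpa [hf0] using hmono (Set.mem_Ici.mpr le_rfl)
      (Set.mem_Ici.mpr (inv_pos.mpr hσ).le) (inv_pos.mpr hσ)
  set G := α / f a⁻¹ + β / f b⁻¹ with hG
  set C := β / f a⁻¹ + α / f b⁻¹ with hC
  have key : ∀ ε : ℝ, 0 < ε → ε ≤ 1 → 1 ≤ f (α * a + β * b)⁻¹ * (G + ε ^ 2 * C) := by
    intro ε hε hε1
    have := one_le_mul_of_operator_inequality hf0 hmono hop (p := √α) (q := √β) ha hb
      (by rw [Real.sq_sqrt hα, Real.sq_sqrt hβ, hαβ]) hε hε1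
    rwa [Real.sq_sqrt hα, Real.sq_sqrt hβ] at this
  have hlim : Filter.Tendsto (fun ε : ℝ => f (α * a + β * b)⁻¹ * (G + ε ^ 2 * C))
      (nhdsWithin 0 (Set.Ioi 0)) (nhds (f (α * a + β * b)⁻¹ * (G + 0 ^ 2 * C))) :=
    (Continuous.tendsto (by fun_prop) 0).mono_left nhdsWithin_le_nhds
  have h1 : 1 ≤ f (α * a + β * b)⁻¹ * (G + 0 ^ 2 * C) := by
    refine ge_of_tendsto hlim ?_
    filter_upwards [Ioo_mem_nhdsGT (zero_lt_one' ℝ)] with ε hε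
    exact key ε hε.1 hε.2.le
  rw [inv_le_iff_one_le_mul₀' hfσ]
  simpa [hG, div_eq_mul_inv] using h1

/-- for a continuous bijection `f : [0,∞) → [0,∞)` with `f(0) = 0`,
the function `g(t) = 1/f(1/t)` is convex on `(0,∞)` iff for every positive
semidefinite `A` and every expansive `Z` (of any size) there is a unitary `U` with
`Zᴴ f(A) Z ≤ U f(ZᴴAZ) Uᴴ`. -/
theorem expansive_convexity_characterization {f : ℝ → ℝ}
    (hcont : ContinuousOn f (Set.Ici 0)) (hf0 : f 0 = 0)
    (hbij : Set.BijOn f (Set.Ici 0) (Set.Ici 0)) :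
    ConvexOn ℝ (Set.Ioi 0) (fun t => (f t⁻¹)⁻¹) ↔
      ∀ n : ℕ, ∀ A : Matrix (Fin n) (Fin n) ℂ, A.PosSemidef →
        ∀ Z : Matrix (Fin n) (Fin n) ℂ, (Zᴴ * Z - 1).PosSemidef →
          ∃ U : Matrix (Fin n) (Fin n) ℂ, Uᴴ * U = 1 ∧
            (U * matFun (Zᴴ * A * Z) f * Uᴴ - Zᴴ * matFun A f * Z).PosSemidef := by
  have hmono := strictMonoOn_of_bijOn hcont hf0 hbij
  refine ⟨fun hconv n A hA Z hZ => ?_, convexOn_of_operator_inequality hf0 hmono⟩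
  have hH : (Zᴴ * A * Z).IsHermitian := isHermitian_conjTranspose_mul_mul Z hA.isHermitian
  have hK : (Zᴴ * matFun A f * Z).IsHermitian :=
    isHermitian_conjTranspose_mul_mul Z (isHermitian_matFun hA.isHermitian f)
  exact exists_unitary_of_eigenvalues_le hH hK
    (eigenvalues_le_of_convexOn hf0 hbij hmono hconv hA hZ hH hK)
end
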